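/- Let (X_t)_{t∈ℕ} be a 1-approximating functional, with summable approximating constants (a_k)_{k≥0}, of a stationary absolutely regular time series, and assume all finite-dimensional distributions of (X_t) are continuous. Then the symbolic correlation integral estimator S_n^d converges in probability to S^d as n → ∞. -/

import Mathlib

open MeasureTheory ProbabilityTheory Filter
open scoped Classical

noncomputable section

/-- The σ-algebra 𝒜ₖˡ = σ(Z_k, …, Z_l). -/
def sigmaIcc {Ω : Type*} [MeasurableSpace Ω] (Z : ℤ → Ω → ℝ) (k l : ℤ) : MeasurableSpace Ω :=
  ⨆ i ∈ Set.Icc k l, MeasurableSpace.comap (Z i) inferInstance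

/-- The σ-algebra 𝒜ₖ^∞ = σ(Z_k, Z_{k+1}, …). -/
def sigmaIci {Ω : Type*} [MeasurableSpace Ω] (Z : ℤ → Ω → ℝ) (k : ℤ) : MeasurableSpace Ω :=
  ⨆ i ∈ Set.Ici k, MeasurableSpace.comap (Z i) inferInstance

/-- A stationary time series. -/
def Stationary {Ω : Type*} [MeasurableSpace Ω] (μ : Measure Ω) (Z : ℤ → Ω → ℝ) : Prop :=
  ∀ t : ℤ, Measure.map (fun ω => fun s : ℤ => Z (s + t) ω) μ
    = Measure.map (fun ω => fun s : ℤ => Z s ω) μ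

/-- The absolute-regularity coefficient of two σ-algebras:
`sup Σ_i Σ_j |P(A_i ∩ B_j) − P(A_i)P(B_j)|`, the supremum taken over all finite
`m₁`-measurable partitions `(A_i)` and all finite `m₂`-measurable partitions `(B_j)`. -/
def betaCoeff {Ω : Type*} [MeasurableSpace Ω] (μ : Measure Ω)
    (m₁ m₂ : MeasurableSpace Ω) : ℝ :=
  sSup {r : ℝ | ∃ (I J : ℕ) (A : Fin I → Set Ω) (B : Fin J → Set Ω),
    (∀ i, MeasurableSet[m₁] (A i)) ∧ (∀ j, MeasurableSet[m₂] (B j)) ∧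
    Pairwise (Function.onFun Disjoint A) ∧ Pairwise (Function.onFun Disjoint B) ∧
    (⋃ i, A i) = Set.univ ∧ (⋃ j, B j) = Set.univ ∧
    r = ∑ i, ∑ j, |(μ (A i ∩ B j)).toReal - (μ (A i)).toReal * (μ (B j)).toReal|}

/-- The mixing coefficient `β_k = sup_n β(σ(Z_1,…,Z_n), σ(Z_{n+k},…))`. -/
def betaMix {Ω : Type*} [MeasurableSpace Ω] (μ : Measure Ω) (Z : ℤ → Ω → ℝ) (k : ℕ) : ℝ :=
  sSup {r : ℝ | ∃ n : ℕ, 1 ≤ n ∧ r = betaCoeff μ (sigmaIcc Z 1 n) (sigmaIci Z (n + k))}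

/-- The ordinal pattern of a vector `x ∈ ℝ^d` (ranks; ties broken by index). -/
def pattern {d : ℕ} (x : Fin d → ℝ) : Equiv.Perm (Fin d) := (Tuple.sort x)⁻¹

/-- The minimal spread of a vector. -/
def minSpread {d : ℕ} (x : Fin d → ℝ) : ℝ :=
  sInf {r : ℝ | ∃ j k : Fin d, j ≠ k ∧ r = |x j - x k|}

/-- The sliding window `X̄_t = (X_t, …, X_{t+d-1})`. -/
def window {Ω : Type*} (X : ℤ → Ω → ℝ) (d : ℕ) (t : ℤ) (ω : Ω) : Fin d → ℝ :=
  fun i => X (t + (i : ℕ)) ω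

/-- The symbolic correlation integral `S^d = Σ_{π ∈ S_d} p_π²`. -/
def SCI {Ω : Type*} [MeasurableSpace Ω] (μ : Measure Ω) (X : ℤ → Ω → ℝ) (d : ℕ) : ℝ :=
  ∑ π : Equiv.Perm (Fin d), ((μ {ω | pattern (window X d 0 ω) = π}).toReal) ^ 2

/-- The estimator `S_n^d = (2/(n(n−1))) Σ_{1≤j<k≤n} 1{Π(X̄_j) = Π(X̄_k)}`. -/
def SCIest {Ω : Type*} (X : ℤ → Ω → ℝ) (d n : ℕ) (ω : Ω) : ℝ :=
  (2 / ((n : ℝ) * ((n : ℝ) - 1))) * ∑ j ∈ Finset.Icc 1 n, ∑ k ∈ Finset.Icc (j + 1) n,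
    if pattern (window X d (j : ℤ) ω) = pattern (window X d (k : ℤ) ω) then (1 : ℝ) else 0

/-- `h₁(x) = ∫ 1{Π(x) = Π(y)} dF(y)` where `F` is the law of `X̄_t`. -/
def h1 {Ω : Type*} [MeasurableSpace Ω] (μ : Measure Ω) (X : ℤ → Ω → ℝ) (d : ℕ) (t : ℤ)
    (x : Fin d → ℝ) : ℝ :=
  ∫ y, (if pattern x = pattern y then (1 : ℝ) else 0) ∂(Measure.map (window X d t) μ)

/-- `Cov(h₁(X̄_s), h₁(X̄_t))` (with `h₁` taken w.r.t. the law of `X̄_0`). -/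
def covH {Ω : Type*} [MeasurableSpace Ω] (μ : Measure Ω) (X : ℤ → Ω → ℝ) (d : ℕ)
    (s t : ℤ) : ℝ :=
  ∫ ω, h1 μ X d 0 (window X d s ω) * h1 μ X d 0 (window X d t ω) ∂μ
    - (∫ ω, h1 μ X d 0 (window X d s ω) ∂μ) * (∫ ω, h1 μ X d 0 (window X d t ω) ∂μ)


lemma sigmaIcc_le {Ω : Type*} [m0 : MeasurableSpace Ω] {Z : ℤ → Ω → ℝ}
    (hZ : ∀ t, Measurable (Z t)) (k l : ℤ) : sigmaIcc Z k l ≤ m0 :=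
  iSup₂_le fun i _ => (hZ i).comap_le

lemma sigmaIci_le {Ω : Type*} [m0 : MeasurableSpace Ω] {Z : ℤ → Ω → ℝ}
    (hZ : ∀ t, Measurable (Z t)) (k : ℤ) : sigmaIci Z k ≤ m0 :=
  iSup₂_le fun i _ => (hZ i).comap_le

lemma sum_real_inter_partition {Ω : Type*} [MeasurableSpace Ω] (μ : Measure Ω)
    [IsProbabilityMeasure μ] {J : ℕ} (A : Set Ω) (B : Fin J → Set Ω)
    (hA : MeasurableSet A) (hB : ∀ j, MeasurableSet (B j))
    (hd : Pairwise (Function.onFun Disjoint B)) (hu : (⋃ j, B j) = Set.univ) :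
    ∑ j, μ.real (A ∩ B j) = μ.real A := by
  rw [← measureReal_iUnion_fintype]
  · rw [← Set.inter_iUnion, hu, Set.inter_univ]
  · intro i j hij
    exact (hd hij).mono Set.inter_subset_right Set.inter_subset_right
  · intro j; exact hA.inter (hB j)

lemma beta_elem_le_two {Ω : Type*} {m₁ m₂ : MeasurableSpace Ω} [m0 : MeasurableSpace Ω] (μ : Measure Ω)
    [IsProbabilityMeasure μ] (h1 : m₁ ≤ m0) (h2 : m₂ ≤ m0) (r : ℝ)
    (hr : ∃ (I J : ℕ) (A : Fin I → Set Ω) (B : Fin J → Set Ω),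
    (∀ i, MeasurableSet[m₁] (A i)) ∧ (∀ j, MeasurableSet[m₂] (B j)) ∧
    Pairwise (Function.onFun Disjoint A) ∧ Pairwise (Function.onFun Disjoint B) ∧
    (⋃ i, A i) = Set.univ ∧ (⋃ j, B j) = Set.univ ∧
    r = ∑ i, ∑ j, |(μ (A i ∩ B j)).toReal - (μ (A i)).toReal * (μ (B j)).toReal|) : r ≤ 2 := by
  obtain ⟨I, J, A, B, hA, hB, hdA, hdB, huA, huB, rfl⟩ := hr
  change ∑ i, ∑ j, |μ.real (A i ∩ B j) - μ.real (A i) * μ.real (B j)| ≤ 2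
  have hA' : ∀ i, MeasurableSet (A i) := fun i => h1 _ (hA i)
  have hB' : ∀ i, MeasurableSet (B i) := fun i => h2 _ (hB i)
  have sA : ∑ i, μ.real (A i) = 1 := by
    have := sum_real_inter_partition μ Set.univ A MeasurableSet.univ hA' hdA huA
    simpa using this
  have sB : ∑ i, μ.real (B i) = 1 := by
    have := sum_real_inter_partition μ Set.univ B MeasurableSet.univ hB' hdB huB
    simpa using this
  calc ∑ i, ∑ j, |μ.real (A i ∩ B j) - μ.real (A i) * μ.real (B j)|
      ≤ ∑ i, ∑ j, (μ.real (A i ∩ B j) + μ.real (A i) * μ.real (B j)) := by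
        refine Finset.sum_le_sum fun i _ => Finset.sum_le_sum fun j _ => ?_
        have a1 : 0 ≤ μ.real (A i ∩ B j) := measureReal_nonneg
        have a2 : 0 ≤ μ.real (A i) * μ.real (B j) :=
          mul_nonneg measureReal_nonneg measureReal_nonneg
        rw [abs_le]; constructor <;> linarith
    _ = ∑ i, (μ.real (A i) + μ.real (A i)) := by
        refine Finset.sum_congr rfl fun i _ => ?_
        rw [Finset.sum_add_distrib, sum_real_inter_partition μ (A i) B (hA' i) hB' hdB huB,
          ← Finset.mul_sum, sB, mul_one]
    _ = 2 := by rw [Finset.sum_add_distrib, sA]; norm_num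

lemma betaCoeff_le_two {Ω : Type*} {m₁ m₂ : MeasurableSpace Ω} [m0 : MeasurableSpace Ω] (μ : Measure Ω)
    [IsProbabilityMeasure μ] (h1 : m₁ ≤ m0) (h2 : m₂ ≤ m0) :
    betaCoeff μ m₁ m₂ ≤ 2 :=
  Real.sSup_le (fun r hr => beta_elem_le_two μ h1 h2 r hr) (by norm_num)

lemma partition_pair {Ω : Type*} (A : Set Ω) :
    Pairwise (Function.onFun Disjoint ![A, Aᶜ]) ∧ (⋃ i, (![A, Aᶜ] : Fin 2 → Set Ω) i) = Set.univ := by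
  constructor
  · intro i j hij
    fin_cases i <;> fin_cases j <;> simp_all [Function.onFun, disjoint_compl_right, disjoint_compl_left]
  · ext x
    simp [Fin.exists_fin_two, em]

lemma cov_le_betaCoeff {Ω : Type*} {m₁ m₂ : MeasurableSpace Ω} [m0 : MeasurableSpace Ω] (μ : Measure Ω)
    [IsProbabilityMeasure μ] (h1 : m₁ ≤ m0) (h2 : m₂ ≤ m0)
    {A B : Set Ω} (hA : MeasurableSet[m₁] A) (hB : MeasurableSet[m₂] B) :
    |μ.real (A ∩ B) - μ.real A * μ.real B| ≤ betaCoeff μ m₁ m₂ := by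
  refine le_trans ?_ (le_csSup (a := ∑ i, ∑ j, |(μ ((![A, Aᶜ] : Fin 2 → Set Ω) i ∩ (![B, Bᶜ] : Fin 2 → Set Ω) j)).toReal -
    (μ ((![A, Aᶜ] : Fin 2 → Set Ω) i)).toReal * (μ ((![B, Bᶜ] : Fin 2 → Set Ω) j)).toReal|)
    ⟨2, fun r hr => beta_elem_le_two μ h1 h2 r hr⟩
    ⟨2, 2, ![A, Aᶜ], ![B, Bᶜ], ?_, ?_, (partition_pair A).1, (partition_pair B).1,
      (partition_pair A).2, (partition_pair B).2, rfl⟩)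
  · rw [Fin.sum_univ_two, Fin.sum_univ_two, Fin.sum_univ_two]
    simp only [Matrix.cons_val_zero, Matrix.cons_val_one]
    simp only [Measure.real]
    have := abs_nonneg ((μ (A ∩ Bᶜ)).toReal - (μ A).toReal * (μ Bᶜ).toReal)
    have := abs_nonneg ((μ (Aᶜ ∩ B)).toReal - (μ Aᶜ).toReal * (μ B).toReal)
    have := abs_nonneg ((μ (Aᶜ ∩ Bᶜ)).toReal - (μ Aᶜ).toReal * (μ Bᶜ).toReal)
    linarith
  · intro i; fin_cases i
    · exact hA
    · exact hA.compl
  · intro i; fin_cases i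
    · exact hB
    · exact hB.compl

lemma cov_le_betaMix {Ω : Type*} [m0 : MeasurableSpace Ω] (μ : Measure Ω)
    [IsProbabilityMeasure μ] {Z : ℤ → Ω → ℝ} (hZ : ∀ t, Measurable (Z t)) (n k : ℕ) (hn : 1 ≤ n)
    {A B : Set Ω} (hA : MeasurableSet[sigmaIcc Z 1 n] A)
    (hB : MeasurableSet[sigmaIci Z (n + k)] B) :
    |μ.real (A ∩ B) - μ.real A * μ.real B| ≤ betaMix μ Z k := by
  refine (cov_le_betaCoeff μ (sigmaIcc_le hZ _ _) (sigmaIci_le hZ _) hA hB).trans ?_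
  refine le_csSup ⟨2, ?_⟩ ⟨n, hn, rfl⟩
  rintro r ⟨n, -, rfl⟩
  exact betaCoeff_le_two μ (sigmaIcc_le hZ _ _) (sigmaIci_le hZ _)

/-- The shifted path. -/
def shPath {Ω : Type*} (Z : ℤ → Ω → ℝ) (t : ℤ) (ω : Ω) : ℤ → ℝ := fun s => Z (s + t) ω

lemma measurable_shPath {Ω : Type*} [MeasurableSpace Ω] {Z : ℤ → Ω → ℝ}
    (hZ : ∀ t, Measurable (Z t)) (t : ℤ) : Measurable (shPath Z t) :=
  measurable_pi_lambda _ fun s => hZ (s + t)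

lemma real_shPath {Ω : Type*} [MeasurableSpace Ω] (μ : Measure Ω) {Z : ℤ → Ω → ℝ}
    (hZ : ∀ t, Measurable (Z t)) (hs : Stationary μ Z) (t : ℤ) {A : Set (ℤ → ℝ)}
    (hA : MeasurableSet A) :
    μ.real (shPath Z t ⁻¹' A) = μ.real (shPath Z 0 ⁻¹' A) := by
  have h : ∀ t, Measure.map (shPath Z t) μ = Measure.map (fun ω => fun s : ℤ => Z s ω) μ := hs
  simp only [Measure.real]
  rw [← Measure.map_apply (measurable_shPath hZ t) hA, ← Measure.map_apply (measurable_shPath hZ 0) hA,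
    h, h]

lemma real_shPath_inter {Ω : Type*} [MeasurableSpace Ω] (μ : Measure Ω) {Z : ℤ → Ω → ℝ}
    (hZ : ∀ t, Measurable (Z t)) (hs : Stationary μ Z) (s t : ℤ) {A : Set (ℤ → ℝ)}
    (hA : MeasurableSet A) :
    μ.real (shPath Z s ⁻¹' A ∩ shPath Z (s + t) ⁻¹' A)
      = μ.real (shPath Z 0 ⁻¹' A ∩ shPath Z t ⁻¹' A) := by
  have hm : Measurable (fun z : ℤ → ℝ => fun k : ℤ => z (k + t)) :=
    measurable_pi_lambda _ fun s => measurable_pi_apply _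
  have := real_shPath μ hZ hs s (hA.inter (hm hA))
  rw [Set.preimage_inter, Set.preimage_inter] at this
  have e1 : shPath Z s ⁻¹' ((fun z : ℤ → ℝ => fun k : ℤ => z (k + t)) ⁻¹' A)
      = shPath Z (s + t) ⁻¹' A := by
    have : (fun z : ℤ → ℝ => fun k : ℤ => z (k + t)) ∘ shPath Z s = shPath Z (s + t) := by
      funext ω k
      simp only [shPath, Function.comp]
      congr 1
      ring
    rw [← this]; rfl
  have e2 : shPath Z 0 ⁻¹' ((fun z : ℤ → ℝ => fun k : ℤ => z (k + t)) ⁻¹' A)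
      = shPath Z t ⁻¹' A := by
    have : (fun z : ℤ → ℝ => fun k : ℤ => z (k + t)) ∘ shPath Z 0 = shPath Z t := by
      funext ω k
      simp only [shPath, Function.comp, add_zero]
    rw [← this]; rfl
  rw [e1, e2] at this
  exact this

lemma shPath_cylinder_meas {Ω : Type*} [MeasurableSpace Ω] {Z : ℤ → Ω → ℝ} (m : MeasurableSpace Ω)
    (t : ℤ) (s : Finset ℤ) (S : Set (∀ _ : s, ℝ)) (hS : MeasurableSet S)
    (h : ∀ i ∈ s, Measurable[m] (Z (i + t))) :
    MeasurableSet[m] (shPath Z t ⁻¹' (cylinder s S)) := by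
  have : shPath Z t ⁻¹' (cylinder s S) = (fun ω => fun i : s => Z (i + t) ω) ⁻¹' S := by
    ext ω; rfl
  rw [this]
  exact (@measurable_pi_lambda Ω s (fun _ => ℝ) m _ _ fun i => h i i.2) hS

lemma cov_cylinder {Ω : Type*} [m0 : MeasurableSpace Ω] (μ : Measure Ω)
    [IsProbabilityMeasure μ] {Z : ℤ → Ω → ℝ} (hZ : ∀ t, Measurable (Z t)) (hs : Stationary μ Z)
    {C : Set (ℤ → ℝ)} (hC : C ∈ measurableCylinders (fun _ : ℤ => ℝ)) :
    ∃ m : ℕ, ∀ k : ℕ, |μ.real (shPath Z 0 ⁻¹' C ∩ shPath Z ((2 * m + k : ℕ) : ℤ) ⁻¹' C)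
      - μ.real (shPath Z 0 ⁻¹' C) ^ 2| ≤ betaMix μ Z k := by
  have hCm : MeasurableSet C := MeasurableSet.of_mem_measurableCylinders hC
  obtain ⟨s, S, hS, rfl⟩ := (mem_measurableCylinders _).1 hC
  obtain ⟨m, hm⟩ : ∃ m : ℕ, ∀ i ∈ s, i.natAbs ≤ m :=
    ⟨s.sup Int.natAbs, fun i hi => Finset.le_sup (f := Int.natAbs) hi⟩
  refine ⟨m, fun k => ?_⟩
  rw [← real_shPath_inter μ hZ hs (m + 1) _ hCm]
  have e : μ.real (shPath Z 0 ⁻¹' cylinder s S) ^ 2 = μ.real (shPath Z (m + 1) ⁻¹' cylinder s S)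
      * μ.real (shPath Z (m + 1 + (2 * m + k : ℕ)) ⁻¹' cylinder s S) := by
    rw [real_shPath μ hZ hs (m + 1) hCm, real_shPath μ hZ hs (m + 1 + (2 * m + k : ℕ)) hCm, sq]
  rw [e]
  refine cov_le_betaMix μ hZ (2 * m + 1) k (by omega) ?_ ?_
  · refine shPath_cylinder_meas _ _ _ _ hS fun i hi => ?_
    have := hm i hi
    have h2 : MeasurableSpace.comap (Z (i + (m + 1))) inferInstance ≤
        sigmaIcc Z 1 ((2 * m + 1 : ℕ) : ℤ) :=
      le_iSup₂_of_le (f := fun j (_ : j ∈ Set.Icc (1 : ℤ) ((2 * m + 1 : ℕ) : ℤ)) =>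
        MeasurableSpace.comap (Z j) inferInstance) (i + (m + 1))
        (by constructor <;> push_cast <;> omega) le_rfl
    exact measurable_iff_comap_le.2 h2
  · refine shPath_cylinder_meas _ _ _ _ hS fun i hi => ?_
    have := hm i hi
    have h2 : MeasurableSpace.comap (Z (i + (m + 1 + (2 * m + k : ℕ)))) inferInstance ≤
        sigmaIci Z (((2 * m + 1 : ℕ) : ℤ) + k) :=
      le_iSup₂_of_le (f := fun j (_ : j ∈ Set.Ici (((2 * m + 1 : ℕ) : ℤ) + k)) =>
        MeasurableSpace.comap (Z j) inferInstance) (i + (m + 1 + (2 * m + k : ℕ)))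
        (by simp only [Set.mem_Ici]; push_cast; omega) le_rfl
    exact measurable_iff_comap_le.2 h2

lemma cov_tendsto {Ω : Type*} [m0 : MeasurableSpace Ω] (μ : Measure Ω)
    [IsProbabilityMeasure μ] {Z : ℤ → Ω → ℝ} (hZ : ∀ t, Measurable (Z t)) (hs : Stationary μ Z)
    (hreg : Tendsto (betaMix μ Z) atTop (nhds 0)) {A : Set (ℤ → ℝ)} (hA : MeasurableSet A) :
    Tendsto (fun k : ℕ => μ.real (shPath Z 0 ⁻¹' A ∩ shPath Z (k : ℤ) ⁻¹' A)
      - μ.real (shPath Z 0 ⁻¹' A) ^ 2) atTop (nhds 0) := by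
  rw [Metric.tendsto_atTop]
  intro ε hε
  have : IsProbabilityMeasure (μ.map (shPath Z 0)) :=
    Measure.isProbabilityMeasure_map (measurable_shPath hZ 0).aemeasurable
  have hdense := Measure.MeasureDense.of_generateFrom_isSetAlgebra_finite
    (μ := μ.map (shPath Z 0)) (𝒜 := measurableCylinders (fun _ : ℤ => ℝ))
    isSetAlgebra_measurableCylinders generateFrom_measurableCylinders.symm
  obtain ⟨C, hC, hAC⟩ := hdense.approx A hA (measure_ne_top _ _) (ε / 8) (by positivity)
  have hCm : MeasurableSet C := MeasurableSet.of_mem_measurableCylinders hC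
  have hD : μ.real (shPath Z 0 ⁻¹' (symmDiff A C)) < ε / 8 := by
    rw [Measure.map_apply (measurable_shPath hZ 0) (hA.symmDiff hCm)] at hAC
    rw [Measure.real]
    exact (ENNReal.lt_ofReal_iff_toReal_lt (measure_ne_top _ _)).1 hAC
  obtain ⟨m, hm⟩ := cov_cylinder μ hZ hs hC
  obtain ⟨N, hN⟩ := Metric.tendsto_atTop.1 hreg (ε / 4) (by positivity)
  refine ⟨2 * m + N, fun k hk => ?_⟩
  obtain ⟨j, rfl⟩ : ∃ j, k = 2 * m + j := ⟨k - 2 * m, by omega⟩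
  have b1 := hm j
  have b2 := hN j (by omega)
  rw [Real.dist_eq, sub_zero] at b2 ⊢
  set K : ℤ := ((2 * m + j : ℕ) : ℤ)
  have meas : ∀ t {B : Set (ℤ → ℝ)}, MeasurableSet B → MeasurableSet (shPath Z t ⁻¹' B) :=
    fun t B hB => measurable_shPath hZ t hB
  have b3 : |μ.real (shPath Z 0 ⁻¹' A) - μ.real (shPath Z 0 ⁻¹' C)| ≤ ε / 8 :=
    (abs_measureReal_sub_le_measureReal_symmDiff (meas 0 hA).nullMeasurableSet
      (meas 0 hCm).nullMeasurableSet).trans hD.le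
  have b4 : |μ.real (shPath Z 0 ⁻¹' A ∩ shPath Z K ⁻¹' A)
      - μ.real (shPath Z 0 ⁻¹' C ∩ shPath Z K ⁻¹' C)| ≤ ε / 4 := by
    refine (abs_measureReal_sub_le_measureReal_symmDiff
      ((meas 0 hA).inter (meas K hA)).nullMeasurableSet
      ((meas 0 hCm).inter (meas K hCm)).nullMeasurableSet).trans ?_
    have hsub : symmDiff (shPath Z 0 ⁻¹' A ∩ shPath Z K ⁻¹' A)
        (shPath Z 0 ⁻¹' C ∩ shPath Z K ⁻¹' C) ⊆
        shPath Z 0 ⁻¹' (symmDiff A C) ∪ shPath Z K ⁻¹' (symmDiff A C) := by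
      intro ω
      simp only [Set.mem_symmDiff, Set.mem_inter_iff, Set.mem_union, Set.mem_preimage]
      tauto
    refine (measureReal_mono hsub).trans ((measureReal_union_le _ _).trans ?_)
    rw [real_shPath μ hZ hs K (hA.symmDiff hCm)]
    linarith
  have b5 : |μ.real (shPath Z 0 ⁻¹' A) ^ 2 - μ.real (shPath Z 0 ⁻¹' C) ^ 2| ≤ ε / 4 := by
    rw [sq_sub_sq, abs_mul]
    have h1 : μ.real (shPath Z 0 ⁻¹' A) ≤ 1 := measureReal_le_one
    have h2 : μ.real (shPath Z 0 ⁻¹' C) ≤ 1 := measureReal_le_one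
    have h3 : 0 ≤ μ.real (shPath Z 0 ⁻¹' A) := measureReal_nonneg
    have h4 : 0 ≤ μ.real (shPath Z 0 ⁻¹' C) := measureReal_nonneg
    rw [abs_of_nonneg (add_nonneg h3 h4)]
    nlinarith [abs_nonneg (μ.real (shPath Z 0 ⁻¹' A) - μ.real (shPath Z 0 ⁻¹' C))]
  have b6 := (le_abs_self _).trans_lt b2
  rw [abs_le] at b1 b4 b5
  rw [abs_lt]
  constructor <;> linarith [b1.1, b1.2, b4.1, b4.2, b5.1, b5.2]


lemma sum_dist_le (u : ℕ → ℝ) (hu : ∀ i, 0 ≤ u i) (n j : ℕ) (hj : j ∈ Finset.Icc 1 n) :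
    ∑ k ∈ Finset.Icc 1 n, u (Nat.dist j k) ≤ 2 * ∑ i ∈ Finset.range n, u i := by
  rw [Finset.mem_Icc] at hj
  rw [← Finset.sum_filter_add_sum_filter_not (Finset.Icc 1 n) (fun k => k ≤ j), two_mul]
  have key : ∀ (s : Finset ℕ), (∀ k ∈ s, Nat.dist j k < n) →
      (Set.InjOn (fun k => Nat.dist j k) s) →
      ∑ k ∈ s, u (Nat.dist j k) ≤ ∑ i ∈ Finset.range n, u i := by
    intro s h1 h2
    rw [← Finset.sum_image (f := u) h2]
    refine Finset.sum_le_sum_of_subset_of_nonneg ?_ fun i _ _ => hu i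
    intro i hi
    obtain ⟨k, hk, rfl⟩ := Finset.mem_image.1 hi
    exact Finset.mem_range.2 (h1 k hk)
  refine add_le_add (key _ ?_ ?_) (key _ ?_ ?_)
  · intro k hk
    simp only [Finset.mem_filter, Finset.mem_Icc] at hk
    simp only [Nat.dist]; omega
  · intro k hk l hl h
    simp only [Finset.coe_filter, Finset.mem_Icc, Set.mem_ofPred_eq] at hk hl
    simp only [Nat.dist] at h; omega
  · intro k hk
    simp only [Finset.mem_filter, Finset.mem_Icc] at hk
    simp only [Nat.dist]; omega
  · intro k hk l hl h
    simp only [Finset.coe_filter, Finset.mem_Icc, Set.mem_ofPred_eq] at hk hl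
    simp only [Nat.dist] at h; omega

lemma integral_centered {Ω : Type*} [MeasurableSpace Ω] (μ : Measure Ω) [IsProbabilityMeasure μ]
    {E F : Set Ω} (hE : MeasurableSet E) (hF : MeasurableSet F) (p : ℝ)
    (hEp : μ.real E = p) (hFp : μ.real F = p) :
    ∫ ω, (E.indicator (fun _ => (1 : ℝ)) ω - p) * (F.indicator (fun _ => (1 : ℝ)) ω - p) ∂μ
      = μ.real (E ∩ F) - p ^ 2 := by
  have iE : Integrable (E.indicator (fun _ => (1 : ℝ))) μ := (integrable_const 1).indicator hE
  have iF : Integrable (F.indicator (fun _ => (1 : ℝ))) μ := (integrable_const 1).indicator hF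
  have iEF : Integrable ((E ∩ F).indicator (fun _ => (1 : ℝ))) μ :=
    (integrable_const 1).indicator (hE.inter hF)
  have i2 : Integrable (fun ω => (E ∩ F).indicator (fun _ => (1 : ℝ)) ω
      - p * E.indicator (fun _ => (1 : ℝ)) ω) μ := iEF.sub (iE.const_mul p)
  have i3 : Integrable (fun ω => (E ∩ F).indicator (fun _ => (1 : ℝ)) ω
      - p * E.indicator (fun _ => (1 : ℝ)) ω - p * F.indicator (fun _ => (1 : ℝ)) ω) μ :=
    i2.sub (iF.const_mul p)
  have : ∀ ω, (E.indicator (fun _ => (1 : ℝ)) ω - p) * (F.indicator (fun _ => (1 : ℝ)) ω - p)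
      = (E ∩ F).indicator (fun _ => (1 : ℝ)) ω - p * E.indicator (fun _ => (1 : ℝ)) ω
        - p * F.indicator (fun _ => (1 : ℝ)) ω + p ^ 2 := by
    intro ω
    by_cases h1 : ω ∈ E <;> by_cases h2 : ω ∈ F <;> simp [h1, h2] <;> ring
  simp_rw [this]
  rw [integral_add i3 (integrable_const _),
    integral_sub i2 (iF.const_mul p), integral_sub iEF (iE.const_mul p),
    integral_const_mul, integral_const_mul, integral_indicator_const _ hE,
    integral_indicator_const _ hF, integral_indicator_const _ (hE.inter hF), hEp, hFp]
  simp
  ring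

/-- Empirical frequency. -/
def empFreq {Ω : Type*} (E : ℕ → Set Ω) (n : ℕ) (ω : Ω) : ℝ :=
  (n : ℝ)⁻¹ * ∑ j ∈ Finset.Icc 1 n, (E j).indicator (fun _ => (1 : ℝ)) ω

lemma empFreq_tendsto {Ω : Type*} [MeasurableSpace Ω] (μ : Measure Ω) [IsProbabilityMeasure μ]
    (E : ℕ → Set Ω) (hE : ∀ j, MeasurableSet (E j)) (p : ℝ) (c : ℕ → ℝ)
    (hp : ∀ j, μ.real (E j) = p) (hc : ∀ j k, μ.real (E j ∩ E (j + k)) - p ^ 2 = c k)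
    (hc0 : Tendsto c atTop (nhds 0)) (δ : ℝ) (hδ : 0 < δ) :
    Tendsto (fun n => μ.real {ω | δ ≤ |empFreq E n ω - p|}) atTop (nhds 0) := by
  have hces : Tendsto (fun n : ℕ => (n : ℝ)⁻¹ * ∑ i ∈ Finset.range n, |c i|) atTop (nhds 0) := by
    have := hc0.abs
    rw [abs_zero] at this
    exact this.cesaro
  have hlim : Tendsto (fun n : ℕ => (2 * ((n : ℝ)⁻¹ * ∑ i ∈ Finset.range n, |c i|)) / δ ^ 2)
      atTop (nhds 0) := by
    simpa using (hces.const_mul 2).div_const (δ ^ 2)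
  refine tendsto_of_tendsto_of_tendsto_of_le_of_le' tendsto_const_nhds hlim
    (Eventually.of_forall fun n => measureReal_nonneg) ?_
  filter_upwards [eventually_ge_atTop 1] with n hn
  have hn0 : (n : ℝ) ≠ 0 := by positivity
  set g : ℕ → Ω → ℝ := fun j ω => (E j).indicator (fun _ => (1 : ℝ)) ω - p with hg
  have hgm : ∀ j, Measurable (g j) := fun j =>
    (measurable_const.indicator (hE j)).sub measurable_const
  have hdist : ∀ j k, μ.real (E j ∩ E k) - p ^ 2 = c (Nat.dist j k) := by
    intro j k
    rcases le_total j k with h | h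
    · obtain ⟨l, rfl⟩ := Nat.exists_eq_add_of_le h
      rw [hc, Nat.dist_eq_sub_of_le h]; congr 1; omega
    · obtain ⟨l, rfl⟩ := Nat.exists_eq_add_of_le h
      rw [Set.inter_comm, hc, Nat.dist_eq_sub_of_le_right h]; congr 1; omega
  have hgi : ∀ j k, Integrable (fun ω => g j ω * g k ω) μ := by
    intro j k
    refine Integrable.of_bound ((hgm j).mul (hgm k)).aestronglyMeasurable
      ((1 + |p|) * (1 + |p|)) (Eventually.of_forall fun ω => ?_)
    have hb : ∀ j, |g j ω| ≤ 1 + |p| := by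
      intro j
      refine (abs_sub _ _).trans ?_
      by_cases h : ω ∈ E j <;> simp [h]
    rw [Real.norm_eq_abs, abs_mul]
    exact mul_le_mul (hb j) (hb k) (abs_nonneg _) (by positivity)
  have hexp : ∀ ω, (empFreq E n ω - p) ^ 2
      = ((n : ℝ)⁻¹) ^ 2 * ∑ j ∈ Finset.Icc 1 n, ∑ k ∈ Finset.Icc 1 n, g j ω * g k ω := by
    intro ω
    have : empFreq E n ω - p = (n : ℝ)⁻¹ * ∑ j ∈ Finset.Icc 1 n, g j ω := by
      simp only [hg, empFreq, Finset.sum_sub_distrib, Finset.sum_const, Nat.card_Icc,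
        Nat.add_sub_cancel, nsmul_eq_mul]
      field_simp
    rw [this, mul_pow, sq (∑ j ∈ Finset.Icc 1 n, g j ω), Finset.sum_mul_sum]
  have hint : Integrable (fun ω => (empFreq E n ω - p) ^ 2) μ := by
    simp_rw [hexp]
    exact (integrable_finsetSum _ fun j _ => integrable_finsetSum _ fun k _ => hgi j k).const_mul _
  have hvar : ∫ ω, (empFreq E n ω - p) ^ 2 ∂μ
      ≤ 2 * ((n : ℝ)⁻¹ * ∑ i ∈ Finset.range n, |c i|) := by
    simp_rw [hexp]
    rw [integral_const_mul, integral_finsetSum _ fun j _ =>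
      integrable_finsetSum _ fun k _ => hgi j k]
    have : ∀ j ∈ Finset.Icc 1 n, ∫ ω, ∑ k ∈ Finset.Icc 1 n, g j ω * g k ω ∂μ
        ≤ 2 * ∑ i ∈ Finset.range n, |c i| := by
      intro j hj
      rw [integral_finsetSum _ fun k _ => hgi j k]
      refine le_trans (Finset.sum_le_sum fun k _ => ?_)
        (sum_dist_le (fun i => |c i|) (fun i => abs_nonneg _) n j hj)
      rw [hg, integral_centered μ (hE j) (hE k) p (hp j) (hp k), hdist]
      exact le_abs_self _
    calc _ ≤ ((n : ℝ)⁻¹) ^ 2 * ∑ j ∈ Finset.Icc 1 n, (2 * ∑ i ∈ Finset.range n, |c i|) :=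
          mul_le_mul_of_nonneg_left (Finset.sum_le_sum this) (by positivity)
      _ = _ := by
        rw [Finset.sum_const, Nat.card_Icc, Nat.add_sub_cancel, nsmul_eq_mul]
        field_simp
  rw [le_div_iff₀ (by positivity), mul_comm]
  refine le_trans ?_ hvar
  refine le_trans ?_ (mul_meas_ge_le_integral_of_nonneg
    (Eventually.of_forall fun ω => sq_nonneg _) hint (δ ^ 2))
  refine mul_le_mul_of_nonneg_left (measureReal_mono ?_) (by positivity)
  intro ω hω
  simp only [Set.mem_ofPred_eq] at hω ⊢
  rw [← sq_abs (empFreq E n ω - p)]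
  exact pow_le_pow_left₀ hδ.le hω 2

lemma sum_sym (F : ℕ → ℕ → ℝ) (hF : ∀ j k, F j k = F k j) (n : ℕ) :
    ∑ j ∈ Finset.Icc 1 n, ∑ k ∈ Finset.Icc 1 n, F j k
      = ∑ j ∈ Finset.Icc 1 n, F j j
        + 2 * ∑ j ∈ Finset.Icc 1 n, ∑ k ∈ Finset.Icc (j + 1) n, F j k := by
  induction n with
  | zero => simp
  | succ n ih =>
    have h1 : ∀ j ∈ Finset.Icc 1 n, ∑ k ∈ Finset.Icc (j + 1) (n + 1), F j k
        = ∑ k ∈ Finset.Icc (j + 1) n, F j k + F j (n + 1) := by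
      intro j hj
      rw [Finset.mem_Icc] at hj
      rw [Finset.sum_Icc_succ_top (by omega)]
    have h2 : ∑ k ∈ Finset.Icc (n + 1 + 1) (n + 1), F (n + 1) k = 0 := by simp
    rw [Finset.sum_Icc_succ_top (by omega), Finset.sum_Icc_succ_top (by omega),
      Finset.sum_Icc_succ_top (by omega) (fun j => ∑ k ∈ Finset.Icc (j + 1) (n + 1), F j k),
      Finset.sum_congr rfl h1, h2, Finset.sum_Icc_succ_top (by omega)]
    simp_rw [Finset.sum_Icc_succ_top (show 1 ≤ n + 1 by omega)]
    rw [Finset.sum_add_distrib, Finset.sum_add_distrib, ih,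
      Finset.sum_congr rfl fun k _ => hF (n + 1) k]
    ring

lemma det_bound {P : Type*} [Fintype P] [DecidableEq P] (pat : ℕ → P) (n : ℕ) (hn : 2 ≤ n) (q : P → ℝ)
    (hq : ∀ π, q π = (n : ℝ)⁻¹ * ∑ j ∈ Finset.Icc 1 n, if pat j = π then (1 : ℝ) else 0) :
    |(2 / ((n : ℝ) * ((n : ℝ) - 1))) * (∑ j ∈ Finset.Icc 1 n, ∑ k ∈ Finset.Icc (j + 1) n,
      if pat j = pat k then (1 : ℝ) else 0) - ∑ π, q π ^ 2| ≤ 1 / ((n : ℝ) - 1) := by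
  have hn' : (2 : ℝ) ≤ n := by exact_mod_cast hn
  have hn0 : (n : ℝ) ≠ 0 := by linarith
  have hn1 : (0 : ℝ) < (n : ℝ) - 1 := by linarith
  have hQ : ∑ π, q π ^ 2 = ((n : ℝ)⁻¹) ^ 2 * ∑ j ∈ Finset.Icc 1 n, ∑ k ∈ Finset.Icc 1 n,
      if pat j = pat k then (1 : ℝ) else 0 := by
    simp_rw [hq, mul_pow, sq (∑ j ∈ Finset.Icc 1 n, _), Finset.sum_mul_sum]
    rw [← Finset.mul_sum, Finset.sum_comm]
    congr 1
    refine Finset.sum_congr rfl fun j _ => ?_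
    rw [Finset.sum_comm]
    refine Finset.sum_congr rfl fun k _ => ?_
    rw [Finset.sum_eq_single (pat j)]
    · simp [eq_comm]
    · intro b _ hb
      simp [hb.symm]
    · simp
  have hsym := sum_sym (fun j k => if pat j = pat k then (1 : ℝ) else 0)
    (fun j k => by simp [eq_comm]) n
  have hle : ∑ j ∈ Finset.Icc 1 n, ∑ k ∈ Finset.Icc 1 n, (if pat j = pat k then (1 : ℝ) else 0)
      ≤ (n : ℝ) ^ 2 := by
    calc _ ≤ ∑ j ∈ Finset.Icc 1 n, ∑ k ∈ Finset.Icc 1 n, (1 : ℝ) :=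
          Finset.sum_le_sum fun j _ => Finset.sum_le_sum fun k _ => by split_ifs <;> norm_num
      _ = _ := by simp [sq]
  simp only [if_true, Finset.sum_const, Nat.card_Icc, Nat.add_sub_cancel, nsmul_eq_mul,
    mul_one] at hsym
  have hQ0 : 0 ≤ ∑ π, q π ^ 2 := Finset.sum_nonneg fun _ _ => sq_nonneg _
  have hQ1 : ∑ π, q π ^ 2 ≤ 1 := by
    rw [hQ, inv_pow, inv_mul_le_iff₀ (by positivity), mul_one]
    exact hle
  rw [hsym] at hQ
  set T := ∑ j ∈ Finset.Icc 1 n, ∑ k ∈ Finset.Icc (j + 1) n,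
    (if pat j = pat k then (1 : ℝ) else 0)
  have key : 2 / ((n : ℝ) * ((n : ℝ) - 1)) * T - ∑ π, q π ^ 2
      = (∑ π, q π ^ 2 - 1) / ((n : ℝ) - 1) := by
    rw [hQ]
    have := hn1.ne'
    field_simp
    ring
  rw [key, abs_div, abs_of_pos hn1]
  refine div_le_div_of_nonneg_right ?_ hn1.le
  rw [abs_le]; constructor <;> linarith

lemma measurable_pattern {d : ℕ} (π : Equiv.Perm (Fin d)) :
    MeasurableSet {x : Fin d → ℝ | pattern x = π} := by
  have : {x : Fin d → ℝ | pattern x = π} = {x | (∀ i j, i ≤ j → x (π⁻¹ i) ≤ x (π⁻¹ j)) ∧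
      ∀ i j, i < j → x (π⁻¹ i) = x (π⁻¹ j) → π⁻¹ i < π⁻¹ j} := by
    ext x
    simp only [Set.mem_ofPred_eq, pattern]
    rw [inv_eq_iff_eq_inv, eq_comm, Tuple.eq_sort_iff]
    rfl
  rw [this]
  simp only [Set.ofPred_and, Set.ofPred_forall]
  refine MeasurableSet.inter ?_ ?_
  · refine MeasurableSet.iInter fun i => MeasurableSet.iInter fun j => MeasurableSet.iInter fun _ =>
      measurableSet_le (measurable_pi_apply _) (measurable_pi_apply _)
  · refine MeasurableSet.iInter fun i => MeasurableSet.iInter fun j => MeasurableSet.iInter fun _ => ?_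
    by_cases h : π⁻¹ i < π⁻¹ j
    · have : {x : Fin d → ℝ | x (π⁻¹ i) = x (π⁻¹ j) → π⁻¹ i < π⁻¹ j} = Set.univ :=
        Set.eq_univ_of_forall fun x _ => h
      rw [this]; exact MeasurableSet.univ
    · have : {x : Fin d → ℝ | x (π⁻¹ i) = x (π⁻¹ j) → π⁻¹ i < π⁻¹ j}
          = {x : Fin d → ℝ | x (π⁻¹ i) = x (π⁻¹ j)}ᶜ := by
        ext x; exact ⟨fun hx he => h (hx he), fun hx he => absurd he hx⟩
      rw [this]
      have hm : ∀ l : Fin d, Measurable (fun x : Fin d → ℝ => x l) := fun l => measurable_pi_apply l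
      exact (measurableSet_eq_fun (hm _) (hm _)).compl

/-- Law of large numbers for the symbolic correlation integral:
If `(X_t)` is a 1-approximating functional, with summable approximating constants, of a
stationary absolutely regular time series, and all finite-dimensional distributions of
`(X_t)` are continuous (no ties a.s.), then `S_n^d → S^d` in probability. -/
theorem stmt_3 {Ω : Type*} [MeasurableSpace Ω] (μ : Measure Ω) [IsProbabilityMeasure μ]
    (Z : ℤ → Ω → ℝ) (hZmeas : ∀ t, Measurable (Z t)) (hstat : Stationary μ Z)
    (hreg : Tendsto (betaMix μ Z) atTop (nhds 0))
    (f : (ℤ → ℝ) → ℝ) (hf : Measurable f)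
    (X : ℤ → Ω → ℝ) (hX : ∀ t ω, X t ω = f (fun k => Z (t + k) ω))
    (a : ℕ → ℝ) (ha0 : Tendsto a atTop (nhds 0)) (hsum : Summable a)
    (happrox : ∀ k : ℕ,
      ∫ ω, |X 0 ω - (μ[X 0 | sigmaIcc Z (-(k : ℤ)) (k : ℤ)]) ω| ∂μ ≤ a k)
    (hcont : ∀ i j : ℤ, i ≠ j → μ {ω | X i ω = X j ω} = 0)
    (d : ℕ) :
    TendstoInMeasure μ (fun n ω => SCIest X d n ω) atTop (fun _ => SCI μ X d) := by
  set A : Equiv.Perm (Fin d) → Set (ℤ → ℝ) := fun π =>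
    {z | pattern (fun i : Fin d => f (fun k => z (k + ((i : ℕ) : ℤ)))) = π} with hAdef
  have hA : ∀ π, MeasurableSet (A π) := by
    intro π
    have hm : Measurable (fun z : ℤ → ℝ => fun i : Fin d => f (fun k => z (k + ((i : ℕ) : ℤ)))) :=
      measurable_pi_lambda _ fun i => hf.comp (measurable_pi_lambda _ fun k => measurable_pi_apply _)
    exact hm (measurable_pattern π)
  have hpre : ∀ (t : ℤ) (π), {ω | pattern (window X d t ω) = π} = shPath Z t ⁻¹' (A π) := by
    intro t π
    ext ω
    simp only [Set.mem_ofPred_eq, Set.mem_preimage, hAdef, shPath]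
    have : window X d t ω = fun i : Fin d => f (fun k => Z (k + ((i : ℕ) : ℤ) + t) ω) := by
      funext i
      rw [window, hX]
      congr 1
      funext k
      congr 1
      ring
    rw [this]
  set p : Equiv.Perm (Fin d) → ℝ := fun π => μ.real (shPath Z 0 ⁻¹' (A π)) with hpdef
  have hSCI : SCI μ X d = ∑ π, p π ^ 2 := by
    simp only [SCI, hpdef, Measure.real, hpre]
  set E : Equiv.Perm (Fin d) → ℕ → Set Ω := fun π j => shPath Z (j : ℤ) ⁻¹' (A π) with hEdef
  have hconv : ∀ π (δ : ℝ), 0 < δ →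
      Tendsto (fun n => μ.real {ω | δ ≤ |empFreq (E π) n ω - p π|}) atTop (nhds 0) := by
    intro π δ hδ
    refine empFreq_tendsto μ (E π) (fun j => measurable_shPath hZmeas _ (hA π)) (p π) _
      (fun j => real_shPath μ hZmeas hstat _ (hA π)) ?_
      (cov_tendsto μ hZmeas hstat hreg (hA π)) δ hδ
    intro j k
    simp only [hEdef]
    rw [Nat.cast_add, real_shPath_inter μ hZmeas hstat _ _ (hA π)]
  rw [tendstoInMeasure_iff_measureReal_norm]
  intro ε hε
  set M : ℝ := (Fintype.card (Equiv.Perm (Fin d)) : ℝ) with hM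
  have hMpos : 0 < M := by
    rw [hM]; exact_mod_cast Fintype.card_pos
  have hδ : 0 < ε / (4 * M) := by positivity
  have hsumlim : Tendsto (fun n => ∑ π, μ.real {ω | ε / (4 * M) ≤ |empFreq (E π) n ω - p π|})
      atTop (nhds 0) := by
    have := tendsto_finsetSum (Finset.univ : Finset (Equiv.Perm (Fin d)))
      (fun π _ => hconv π (ε / (4 * M)) hδ)
    simpa using this
  refine tendsto_of_tendsto_of_tendsto_of_le_of_le' tendsto_const_nhds hsumlim
    (Eventually.of_forall fun n => measureReal_nonneg) ?_
  obtain ⟨N, hN⟩ := exists_nat_gt (2 / ε)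
  filter_upwards [eventually_ge_atTop (N + 2)] with n hn
  refine le_trans (measureReal_mono ?_) (measureReal_iUnion_fintype_le _)
  intro ω hω
  simp only [Set.mem_ofPred_eq, Set.mem_iUnion] at hω ⊢
  by_contra! hcon
  have hn' : (N : ℝ) + 2 ≤ n := by exact_mod_cast hn
  have hpos : (0 : ℝ) < (n : ℝ) - 1 := by
    have : (0 : ℝ) ≤ N := Nat.cast_nonneg N
    linarith
  have b0 : 1 / ((n : ℝ) - 1) < ε / 2 := by
    rw [div_lt_iff₀ hpos]
    rw [div_lt_iff₀ hε] at hN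
    nlinarith
  have b1 := det_bound (fun j : ℕ => pattern (window X d (j : ℤ) ω)) n (by omega)
    (fun π => empFreq (E π) n ω) (by
      intro π
      simp only [empFreq]
      congr 1
      refine Finset.sum_congr rfl fun j _ => ?_
      simp only [hEdef, ← hpre, Set.indicator_apply, Set.mem_ofPred_eq])
  have hq0 : ∀ π, 0 ≤ empFreq (E π) n ω := fun π =>
    mul_nonneg (by positivity) (Finset.sum_nonneg fun j _ =>
      Set.indicator_nonneg (fun _ _ => zero_le_one) _)
  have hq1 : ∀ π, empFreq (E π) n ω ≤ 1 := by
    intro π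
    rw [empFreq, inv_mul_le_iff₀ (by linarith), mul_one]
    calc _ ≤ ∑ j ∈ Finset.Icc 1 n, (1 : ℝ) := Finset.sum_le_sum fun j _ =>
            Set.indicator_le_self' (fun _ _ => zero_le_one) _
      _ = n := by simp
  have b2 : |∑ π, empFreq (E π) n ω ^ 2 - ∑ π, p π ^ 2| ≤ ε / 2 := by
    rw [← Finset.sum_sub_distrib]
    refine (Finset.abs_sum_le_sum_abs _ _).trans ?_
    calc _ ≤ ∑ _π : Equiv.Perm (Fin d), 2 * (ε / (4 * M)) := by
          refine Finset.sum_le_sum fun π _ => ?_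
          have h1 : p π ≤ 1 := measureReal_le_one
          have h2 : 0 ≤ p π := measureReal_nonneg
          rw [sq_sub_sq, abs_mul, abs_of_nonneg (add_nonneg (hq0 π) h2)]
          exact mul_le_mul (by linarith [hq1 π]) (hcon π).le (abs_nonneg _) (by norm_num)
      _ = ε / 2 := by
          rw [Finset.sum_const, nsmul_eq_mul, Finset.card_univ, ← hM]
          field_simp
          norm_num
  rw [Real.norm_eq_abs, hSCI] at hω
  have b3 := abs_sub_le (SCIest X d n ω) (∑ π, empFreq (E π) n ω ^ 2) (∑ π, p π ^ 2)
  have b4 : |SCIest X d n ω - ∑ π, empFreq (E π) n ω ^ 2| ≤ 1 / ((n : ℝ) - 1) := by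
    rw [SCIest]
    convert b1 using 8
  linarith
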